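/- arXiv:2203.02862 — 2 statements merged into one kernel-verified Lean document; each statement's English description precedes it below -/
import Mathlib

section
/- Let D denote the unique ℂ-linear derivation on the polynomial ring ℂ[x_0, x_1, x_2, …] with D(x_i) = x_{i+1} for every i ≥ 0. Let n ≥ 1 and 0 ≤ d ≤ n. If ρ ∈ S_{n,d} (a polynomial in x_0, …, x_{n−1}), then Dρ, which is a polynomial in x_0, …, x_n, belongs to S_{n+1,d}. -/
open MvPolynomial

/-- The jet inversion: given the jets `a j = x^{(j)}(t₀)` of a function `x` with
`x(t₀) ≠ 0`, `iota a j = (1/x)^{(j)}(t₀)`, defined by `iota a 0 = 1 / a 0` and the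
recursion `∑_{j=0}^{k} (k.choose j) * a j * iota a (k - j) = 0` for `k ≥ 1`. -/
noncomputable def iota (a : ℕ → ℂ) : ℕ → ℂ
  | 0 => 1 / a 0
  | (k+1) => -(1 / a 0) * ∑ j ∈ Finset.range (k+1),
      ((k+1).choose (j+1) : ℂ) * a (j+1) * iota a (k - j)
  termination_by k => k
  decreasing_by exact Nat.lt_succ_of_le (Nat.sub_le k j)

/-- `JetRel n ρ₁ ρ₂` means `ρ₁ ∼ₙ ρ₂`:  `ρ₁(a) = a₀ⁿ ρ₂(ιₙ(a))` whenever `a₀ ≠ 0`. -/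
def JetRel (n : ℕ) (ρ₁ ρ₂ : MvPolynomial ℕ ℂ) : Prop :=
  ∀ a : ℕ → ℂ, a 0 ≠ 0 → eval a ρ₁ = (a 0) ^ n * eval (iota a) ρ₂

/-- The space `Sₙ` of polynomials `ρ₁ ∈ ℂ[x₀, …, x_{n-1}]` such that `ρ₁ ∼ₙ ρ₂` for some
polynomial `ρ₂ ∈ ℂ[x₀, …, x_{n-1}]`. -/
noncomputable def Sn (n : ℕ) : Submodule ℂ (MvPolynomial ℕ ℂ) where
  carrier := {ρ₁ | ρ₁ ∈ supported ℂ (Set.Iio n) ∧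
    ∃ ρ₂ ∈ supported ℂ (Set.Iio n), JetRel n ρ₁ ρ₂}
  add_mem' := by
    rintro p q ⟨hp, p₂, hp₂, hrp⟩ ⟨hq, q₂, hq₂, hrq⟩
    refine ⟨add_mem hp hq, p₂ + q₂, add_mem hp₂ hq₂, fun a ha => ?_⟩
    simp only [map_add, hrp a ha, hrq a ha, mul_add]
  zero_mem' := ⟨zero_mem _, 0, zero_mem _, fun a ha => by simp⟩
  smul_mem' := by
    rintro c p ⟨hp, p₂, hp₂, hrp⟩
    refine ⟨Subalgebra.smul_mem _ hp c, c • p₂, Subalgebra.smul_mem _ hp₂ c, fun a ha => ?_⟩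
    simp only [MvPolynomial.smul_eq_C_mul, map_mul, eval_C, hrp a ha]
    ring

/-- `S_{n,d}`: the homogeneous degree-`d` part of `Sₙ`. -/
noncomputable def Snd (n d : ℕ) : Submodule ℂ (MvPolynomial ℕ ℂ) :=
  Sn n ⊓ homogeneousSubmodule ℕ ℂ d

/-- `S_{n,d,l}`: the part of `S_{n,d}` of weighted degree `l`, where variable `xᵢ`
has weight `i`. -/
noncomputable def Sndl (n d l : ℕ) : Submodule ℂ (MvPolynomial ℕ ℂ) :=
  Snd n d ⊓ weightedHomogeneousSubmodule ℂ (fun i : ℕ => i) l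

theorem iota_zero (a : ℕ → ℂ) : iota a 0 = 1 / a 0 := by
  rw [iota]

theorem iota_succ (a : ℕ → ℂ) (k : ℕ) :
    iota a (k + 1) = -(1 / a 0) * ∑ j ∈ Finset.range (k + 1),
      ((k + 1).choose (j + 1) : ℂ) * a (j + 1) * iota a (k - j) := by
  rw [iota]

/-- Jet inversion intertwines the total derivative: along a curve of jets whose velocity at `t₀`
is the shifted jet, the velocity of the inverted jets is the shifted inverted jet. -/
theorem hasDerivAt_iota {c : ℂ → ℕ → ℂ} {t₀ : ℂ}
    (hc : ∀ i, HasDerivAt (fun t => c t i) (c t₀ (i + 1)) t₀) (h0 : c t₀ 0 ≠ 0) (k : ℕ) :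
    HasDerivAt (fun t => iota (c t) k) (iota (c t₀) (k + 1)) t₀ := by
  have hinv : HasDerivAt (fun t => 1 / c t 0) (-c t₀ 1 / c t₀ 0 ^ 2) t₀ := by
    simpa only [one_div] using (hc 0).fun_inv h0
  induction k using Nat.strong_induction_on with
  | _ k ih =>
    rcases k with _ | k
    · simp only [iota_zero]
      convert hinv using 1
      rw [iota_succ]
      simp [iota_zero]
      field_simp
    · have hsum : HasDerivAt (fun t => ∑ j ∈ Finset.range (k + 1),
          ((k + 1).choose (j + 1) : ℂ) * c t (j + 1) * iota (c t) (k - j))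
          (∑ j ∈ Finset.range (k + 1),
            (((k + 1).choose (j + 1) : ℂ) * c t₀ (j + 2) * iota (c t₀) (k - j) +
              ((k + 1).choose (j + 1) : ℂ) * c t₀ (j + 1) * iota (c t₀) (k - j + 1))) t₀ :=
        HasDerivAt.fun_sum fun j _ =>
          ((hc (j + 1)).const_mul _).mul (ih (k - j) (by omega))
      have hmul := hinv.fun_neg.fun_mul hsum
      simp only [iota_succ _ k]
      refine hmul.congr_deriv ?_
      have hb := iota_succ (c t₀) k
      have hb' := iota_succ (c t₀) (k + 1)
      set b := iota (c t₀)
      set a := c t₀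
      have hS : ∑ j ∈ Finset.range (k + 1),
          ((k + 1).choose (j + 1) : ℂ) * a (j + 1) * b (k - j) = -(a 0 * b (k + 1)) := by
        rw [hb]
        field_simp
      have hpascal : ∑ j ∈ Finset.range (k + 1 + 1),
          ((k + 1 + 1).choose (j + 1) : ℂ) * a (j + 1) * b (k + 1 - j) =
          a 1 * b (k + 1) + ∑ j ∈ Finset.range (k + 1),
            (((k + 1).choose (j + 1) : ℂ) * a (j + 2) * b (k - j) +
              ((k + 1).choose (j + 1) : ℂ) * a (j + 1) * b (k - j + 1)) := by
        have hsplit : ∀ j, ((k + 1 + 1).choose (j + 1) : ℂ) * a (j + 1) * b (k + 1 - j) =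
            ((k + 1).choose j : ℂ) * a (j + 1) * b (k + 1 - j) +
              ((k + 1).choose (j + 1) : ℂ) * a (j + 1) * b (k + 1 - j) := fun j => by
          rw [Nat.choose_succ_succ (k + 1) j]
          push_cast
          ring
        simp only [hsplit, Finset.sum_add_distrib]
        rw [Finset.sum_range_succ', Finset.sum_range_succ
          (fun j => ((k + 1).choose (j + 1) : ℂ) * a (j + 1) * b (k + 1 - j))]
        have hshift : ∑ j ∈ Finset.range (k + 1),
            ((k + 1).choose (j + 1) : ℂ) * a (j + 1) * b (k + 1 - j) =
            ∑ j ∈ Finset.range (k + 1),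
              ((k + 1).choose (j + 1) : ℂ) * a (j + 1) * b (k - j + 1) :=
          Finset.sum_congr rfl fun j hj => by
            rw [Nat.sub_add_comm (Nat.lt_succ_iff.mp (Finset.mem_range.mp hj))]
        rw [hshift]
        simp
        ring
      rw [hS, hb', hpascal]
      field_simp
      ring

section Derivation

variable {D : Derivation ℂ (MvPolynomial ℕ ℂ) (MvPolynomial ℕ ℂ)}

/-- The chain rule for evaluating a polynomial along a curve of jets whose velocity is the
shifted jet. -/
theorem hasDerivAt_eval_jet (hD : ∀ i : ℕ, D (X i) = X (i + 1)) {c : ℂ → ℕ → ℂ} {t₀ : ℂ}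
    (hc : ∀ i, HasDerivAt (fun t => c t i) (c t₀ (i + 1)) t₀) (p : MvPolynomial ℕ ℂ) :
    HasDerivAt (fun t => eval (c t) p) (eval (c t₀) (D p)) t₀ := by
  induction p using MvPolynomial.induction_on with
  | C r =>
    have hr : D (C r) = 0 := D.map_algebraMap r
    simpa [hr] using hasDerivAt_const t₀ r
  | add p q hp hq => simpa using hp.fun_add hq
  | mul_X p i hp =>
    have h := hp.fun_mul (hc i)
    simp only [map_mul, eval_X]
    refine h.congr_deriv ?_
    simp only [Derivation.leibniz, hD, smul_eq_mul, map_add, map_mul, eval_X]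
    ring

theorem derivation_mem_supported (hD : ∀ i : ℕ, D (X i) = X (i + 1)) {n : ℕ}
    {p : MvPolynomial ℕ ℂ} (hp : p ∈ supported ℂ (Set.Iio n)) :
    D p ∈ supported ℂ (Set.Iio (n + 1)) := by
  have hle : supported ℂ (Set.Iio n) ≤ supported ℂ (Set.Iio (n + 1)) :=
    supported_mono (Set.Iio_subset_Iio n.le_succ)
  rw [supported] at hp
  induction hp using Algebra.adjoin_induction with
  | mem x hx =>
    obtain ⟨i, hi, rfl⟩ := hx
    rw [hD]
    exact X_mem_supported.mpr (Nat.succ_lt_succ hi)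
  | algebraMap r => simp
  | add x y _ _ hx hy => simpa using add_mem hx hy
  | mul x y hx' hy' hx hy =>
    rw [Derivation.leibniz]
    exact add_mem (mul_mem (hle hx') hy) (mul_mem (hle hy') hx)

theorem isHomogeneous_derivation (hD : ∀ i : ℕ, D (X i) = X (i + 1)) {d : ℕ}
    {p : MvPolynomial ℕ ℂ} (hp : p.IsHomogeneous d) : (D p).IsHomogeneous d := by
  have hmk : D = mkDerivation ℂ fun i => X (i + 1) :=
    derivation_ext fun i => by rw [hD, mkDerivation_X]
  rw [p.as_sum, map_sum]
  refine IsHomogeneous.sum _ _ _ fun s hs => ?_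
  have hdeg : s.degree = d := by
    rw [Finsupp.degree_eq_weight_one]
    exact hp (mem_support_iff.mp hs)
  rw [hmk, mkDerivation_monomial, smul_eq_C_mul]
  refine IsHomogeneous.C_mul ?_ _
  refine IsHomogeneous.sum _ _ _ fun i hi => ?_
  have hi' : Finsupp.single i 1 ≤ s := by
    rw [Finsupp.single_le_iff]
    exact Nat.one_le_iff_ne_zero.mpr (Finsupp.mem_support_iff.mp hi)
  have hd : (s - Finsupp.single i 1).degree + 1 = d := by
    rw [← hdeg]
    conv_rhs => rw [← tsub_add_cancel_of_le hi', map_add, Finsupp.degree_single]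
  rw [← hd]
  exact (isHomogeneous_monomial _ rfl).mul (isHomogeneous_X ℂ (i + 1))

/-- If `ρ₁ ∼ₙ ρ₂` then `D ρ₁ ∼ₙ₊₁ x₀ D ρ₂ - n x₁ ρ₂`. -/
theorem JetRel.derivation (hD : ∀ i : ℕ, D (X i) = X (i + 1)) {n : ℕ}
    {p q : MvPolynomial ℕ ℂ} (h : JetRel n p q) :
    JetRel (n + 1) (D p) (X 0 * D q - C (n : ℂ) * X 1 * q) := by
  intro a ha
  let c : ℂ → ℕ → ℂ := fun t i => a i + t * a (i + 1)
  have hc0 : c 0 = a := by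
    funext i
    simp [c]
  have hc : ∀ i, HasDerivAt (fun t => c t i) (c 0 (i + 1)) 0 := fun i => by
    rw [hc0]
    simpa [c] using ((hasDerivAt_id (0 : ℂ)).mul_const (a (i + 1))).const_add (a i)
  have ha' : c 0 0 ≠ 0 := by rwa [hc0]
  have hleft := hasDerivAt_eval_jet hD hc p
  have hright := ((hc 0).fun_pow n).fun_mul
    (hasDerivAt_eval_jet hD (c := fun t => iota (c t)) (hasDerivAt_iota hc ha') q)
  have hev : (fun t => eval (c t) p) =ᶠ[nhds 0] fun t => c t 0 ^ n * eval (iota (c t)) q := by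
    filter_upwards [(hc 0).continuousAt.eventually_ne ha'] with t ht using h _ ht
  have heq := hleft.unique (hright.congr_of_eventuallyEq hev)
  rw [hc0] at heq
  rw [heq]
  have h1 : iota a 1 = -(a 1 / a 0 ^ 2) := by
    rw [iota_succ]
    simp [iota_zero]
    field_simp
  simp only [map_sub, map_mul, eval_X, eval_C, h1, iota_zero]
  rcases n with _ | n
  · simp
    field_simp
  · simp only [Nat.add_sub_cancel]
    field_simp
    ring

end Derivation

/-- **Proposition (D-operator).** Let `D` be the (unique) `ℂ`-linear derivation on
`ℂ[x₀, x₁, x₂, …]` with `D xᵢ = x_{i+1}`. If `1 ≤ n`, `d ≤ n` and `ρ ∈ S_{n,d}`, then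
`D ρ ∈ S_{n+1,d}`. -/
theorem stmt17 (D : Derivation ℂ (MvPolynomial ℕ ℂ) (MvPolynomial ℕ ℂ))
    (hD : ∀ i : ℕ, D (X i) = X (i + 1))
    (n d : ℕ) (hn : 1 ≤ n) (hd : d ≤ n)
    (ρ : MvPolynomial ℕ ℂ) (hρ : ρ ∈ Snd n d) :
    D ρ ∈ Snd (n + 1) d := by
  obtain ⟨⟨hsupp, q, hq, hrel⟩, hhom⟩ := hρ
  refine ⟨⟨derivation_mem_supported hD hsupp, _, ?_, hrel.derivation hD⟩,
    isHomogeneous_derivation hD hhom⟩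
  have hX : ∀ i, i < n + 1 → (X i : MvPolynomial ℕ ℂ) ∈ supported ℂ (Set.Iio (n + 1)) :=
    fun i hi => X_mem_supported.mpr hi
  exact sub_mem (mul_mem (hX 0 (by omega)) (derivation_mem_supported hD hq))
    (mul_mem (mul_mem (Subalgebra.algebraMap_mem _ _) (hX 1 (by omega)))
      (supported_mono (Set.Iio_subset_Iio n.le_succ) hq))
end

section
/- Let n ≥ 1 be an integer and let f, g : ℂ^n → ℂ be entire holomorphic functions such that f(a) = a_0^n · g(ι_n(a)) for every a = (a_0, …, a_{n−1}) ∈ ℂ^n with a_0 ≠ 0. Then f and g are polynomial functions of total degree at most n. -/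
open MvPolynomial

/-- The defining relation of the jet inversion: the jets of `x` and `1 / x` convolve to `0`. -/
lemma sum_choose_mul_iota (a : ℕ → ℂ) (ha : a 0 ≠ 0) (k : ℕ) :
    ∑ j ∈ Finset.range (k + 2), ((k + 1).choose j : ℂ) * a j * iota a (k + 1 - j) = 0 := by
  rw [Finset.sum_range_succ']
  have h : iota a (k + 1) = -(1 / a 0) * ∑ j ∈ Finset.range (k + 1),
      ((k + 1).choose (j + 1) : ℂ) * a (j + 1) * iota a (k - j) := by rw [iota]
  simp only [Nat.add_sub_add_right, Nat.choose_zero_right, Nat.sub_zero, h]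
  field_simp
  simp

/-- The jet inversion is determined by its defining relation. -/
lemma eq_iota_of_sum_choose_mul_eq_zero (n : ℕ) (b c : ℕ → ℂ) (h0 : b 0 * c 0 = 1)
    (h : ∀ k, k + 1 < n →
      ∑ j ∈ Finset.range (k + 2), ((k + 1).choose j : ℂ) * b j * c (k + 1 - j) = 0)
    (k : ℕ) (hk : k < n) : iota b k = c k := by
  have hb : b 0 ≠ 0 := left_ne_zero_of_mul_eq_one h0
  induction k using Nat.strong_induction_on with
  | _ k ih =>
    cases k with
    | zero =>
      rw [iota]
      field_simp
      rw [← h0, mul_comm]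
    | succ k =>
      have h1 := h k hk
      rw [Finset.sum_range_succ'] at h1
      simp only [Nat.add_sub_add_right, Nat.choose_zero_right, Nat.sub_zero] at h1
      rw [iota, Finset.sum_congr rfl fun j _ => by rw [ih (k - j) (by omega) (by omega)]]
      field_simp
      linear_combination -h1

lemma iota_iota (n : ℕ) (a b : ℕ → ℂ) (ha : a 0 ≠ 0) (hn : 0 < n)
    (hb : ∀ k, k < n → b k = iota a k) (k : ℕ) (hk : k < n) : iota b k = a k := by
  refine eq_iota_of_sum_choose_mul_eq_zero n b a ?_ ?_ k hk
  · rw [hb 0 hn, iota]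
    field_simp
  · intro k hk
    rw [← sum_choose_mul_iota a ha k, ← Finset.sum_range_reflect]
    refine Finset.sum_congr rfl fun j hj => ?_
    have hj' : j ≤ k + 1 := by simpa [Nat.lt_succ_iff] using hj
    have h1 : k + 2 - 1 - j = k + 1 - j := by omega
    rw [h1, Nat.sub_sub_self hj', Nat.choose_symm hj', hb _ (by omega)]
    ring

lemma iota_smul (a : ℕ → ℂ) (c : ℂ) (hc : c ≠ 0) (k : ℕ) :
    iota (c • a) k = c⁻¹ * iota a k := by
  induction k using Nat.strong_induction_on with
  | _ k ih =>
    cases k with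
    | zero => simp [iota, mul_comm]
    | succ k =>
      rw [iota, iota, Finset.sum_congr rfl fun j _ => by rw [ih (k - j) (by omega)]]
      simp only [Pi.smul_apply, smul_eq_mul, Finset.mul_sum]
      refine Finset.sum_congr rfl fun j _ => ?_
      field_simp

/-- A multilinear form evaluated on the diagonal is a polynomial function. -/
lemma exists_mvPolynomial_eval_eq_multilinear_diag {n d : ℕ}
    (m : MultilinearMap ℂ (fun _ : Fin d => Fin n → ℂ) ℂ) :
    ∃ P : MvPolynomial (Fin n) ℂ, P.totalDegree ≤ d ∧ ∀ a, m (fun _ => a) = eval a P := by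
  refine ⟨∑ σ : Fin d → Fin n, C (m fun i => Pi.single (σ i) 1) * ∏ i, X (σ i), ?_, fun a => ?_⟩
  · refine totalDegree_finsetSum_le fun σ _ => (totalDegree_mul _ _).trans ?_
    rw [totalDegree_C, zero_add]
    refine (totalDegree_finsetProd _ _).trans ?_
    simp
  · have ha : a = ∑ i, a i • (Pi.single i 1 : Fin n → ℂ) := by
      simpa [← Pi.single_smul] using (Finset.univ_sum_single a).symm
    conv_lhs => rw [ha]
    rw [m.map_sum]
    simp only [map_sum, map_mul, map_prod, eval_C, eval_X]
    refine Finset.sum_congr rfl fun σ _ => ?_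
    rw [m.map_smul_univ, smul_eq_mul, mul_comm]

/-- Liouville's theorem for polynomial growth, in Taylor form. -/
lemma iteratedDeriv_eq_zero_of_growth {h : ℂ → ℂ} (hh : Differentiable ℂ h) {n : ℕ} {M : ℝ}
    (hM : ∀ c, 1 ≤ ‖c‖ → ‖h c‖ ≤ M * ‖c‖ ^ n) {d : ℕ} (hd : n < d) :
    iteratedDeriv d h 0 = 0 := by
  have hb : ∀ R : ℝ, 1 ≤ R → ‖iteratedDeriv d h 0‖ ≤ d.factorial * |M| * R⁻¹ := by
    intro R hR
    have hR0 : 0 < R := by linarith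
    have h1 := Complex.norm_iteratedDeriv_le_of_forall_mem_sphere_norm_le (c := 0) d hR0
      hh.diffContOnCl (C := |M| * R ^ n) (fun z hz => by
        have hz' : ‖z‖ = R := by simpa using hz
        have := hM z (hz' ▸ hR)
        rw [hz'] at this
        exact this.trans (by gcongr; exact le_abs_self M))
    refine h1.trans ?_
    obtain ⟨e, rfl⟩ := Nat.exists_eq_add_of_lt hd
    rw [div_le_iff₀ (by positivity)]
    have h2 : R⁻¹ * R ^ (n + e + 1) = R ^ n * R ^ e := by
      rw [pow_succ, pow_add]
      field_simp
    have h3 : (1 : ℝ) ≤ R ^ e := one_le_pow₀ hR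
    rw [mul_assoc _ R⁻¹, h2, ← mul_assoc, ← mul_assoc]
    exact le_mul_of_one_le_right (by positivity) h3
  have ht : Filter.Tendsto (fun R : ℝ => d.factorial * |M| * R⁻¹) Filter.atTop (nhds 0) := by
    simpa using tendsto_inv_atTop_zero.const_mul ((d.factorial : ℝ) * |M|)
  exact norm_le_zero_iff.mp
    (ge_of_tendsto ht ((Filter.eventually_ge_atTop 1).mono fun R hR => hb R hR))

/-- An entire function on `ℂⁿ` growing at most like `|c| ^ N` along a dense set of complex lines
through the origin is a polynomial of total degree at most `N`. -/
lemma exists_mvPolynomial_of_growth_on_lines {n : ℕ} (N : ℕ) {f : (Fin n → ℂ) → ℂ}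
    (hf : ∀ x, AnalyticAt ℂ f x) {s : Set (Fin n → ℂ)} (hs : Dense s)
    (hM : ∀ a ∈ s, ∃ M : ℝ, ∀ c : ℂ, 1 ≤ ‖c‖ → ‖f (c • a)‖ ≤ M * ‖c‖ ^ N) :
    ∃ P : MvPolynomial (Fin n) ℂ, P.totalDegree ≤ N ∧ ∀ a, f a = eval a P := by
  choose P hPdeg hP using fun d : ℕ =>
    exists_mvPolynomial_eval_eq_multilinear_diag (iteratedFDeriv ℂ d f 0).toMultilinearMap
  refine ⟨∑ d ∈ Finset.range (N + 1), C ((d.factorial : ℂ)⁻¹) * P d, ?_, ?_⟩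
  · refine totalDegree_finsetSum_le fun d hd => (totalDegree_mul _ _).trans ?_
    rw [totalDegree_C, zero_add]
    exact (hPdeg d).trans (Nat.lt_succ_iff.mp (Finset.mem_range.mp hd))
  have hcf : Continuous f := continuous_iff_continuousAt.mpr fun x => (hf x).continuousAt
  refine congrFun (hcf.ext_on hs (MvPolynomial.continuous_eval _) fun a ha => ?_)
  obtain ⟨M, hM⟩ := hM a ha
  let L : ℂ →L[ℂ] (Fin n → ℂ) := ContinuousLinearMap.toSpanSingleton ℂ a
  have hcd : ContDiff ℂ ⊤ f := contDiff_iff_contDiffAt.mpr fun x => (hf x).contDiffAt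
  have hdiff : Differentiable ℂ (f ∘ L) := fun c =>
    (hf (L c)).differentiableAt.comp c L.differentiableAt
  have hderiv : ∀ d : ℕ, iteratedDeriv d (f ∘ L) 0 = eval a (P d) := by
    intro d
    rw [iteratedDeriv_eq_iteratedFDeriv, L.iteratedFDeriv_comp_right hcd 0 le_top, ← hP d]
    simp [L]
  have hzero : ∀ d, N < d → iteratedDeriv d (f ∘ L) 0 = 0 := fun d hd =>
    iteratedDeriv_eq_zero_of_growth hdiff (M := M) (fun c hc => by simpa [L] using hM c hc) hd
  have htaylor := Complex.taylorSeries_eq_of_entire' 0 1 hdiff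
  rw [tsum_eq_sum (s := Finset.range (N + 1))
    (fun d hd => by rw [hzero d (by simpa using hd)]; simp)] at htaylor
  simpa [hderiv, L] using htaylor.symm

/-- An entire function `f` with `f(a) = a₀ⁿ g(b)`, where `b` is the truncated jet inversion of `a` and
`g` is continuous, is a polynomial of total degree at most `n`. -/
lemma exists_mvPolynomial_of_iota_rel (n : ℕ) (hn : 1 ≤ n) (f g : (Fin n → ℂ) → ℂ)
    (hf : ∀ x, AnalyticAt ℂ f x) (hg : Continuous g)
    (hrel : ∀ a : Fin n → ℂ, a ⟨0, hn⟩ ≠ 0 →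
      f a = (a ⟨0, hn⟩) ^ n *
        g (fun i => iota (fun j => if h : j < n then a ⟨j, h⟩ else 0) (i : ℕ))) :
    ∃ P : MvPolynomial (Fin n) ℂ, P.totalDegree ≤ n ∧ ∀ a, f a = eval a P := by
  refine exists_mvPolynomial_of_growth_on_lines n hf (s := {a | a ⟨0, hn⟩ ≠ 0})
    ((dense_compl_singleton (0 : ℂ)).preimage (isOpenMap_eval (⟨0, hn⟩ : Fin n))) ?_
  intro a ha
  set b : Fin n → ℂ := fun i => iota (fun j => if h : j < n then a ⟨j, h⟩ else 0) (i : ℕ) with hb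
  obtain ⟨M, hM⟩ := (isCompact_closedBall (0 : Fin n → ℂ) ‖b‖).exists_bound_of_continuousOn
    hg.continuousOn
  refine ⟨‖a ⟨0, hn⟩‖ ^ n * M, fun c hc => ?_⟩
  have hc0 : c ≠ 0 := norm_pos_iff.mp (by linarith)
  have hι : (fun i : Fin n => iota (fun j => if h : j < n then (c • a) ⟨j, h⟩ else 0) (i : ℕ))
      = c⁻¹ • b := by
    funext i
    rw [Pi.smul_apply, smul_eq_mul, hb, ← iota_smul _ c hc0]
    congr 1
    funext j
    by_cases h : j < n <;> simp [h]
  rw [hrel (c • a) (mul_ne_zero hc0 ha), hι, norm_mul, norm_pow, Pi.smul_apply, norm_smul, mul_pow]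
  have hball : c⁻¹ • b ∈ Metric.closedBall (0 : Fin n → ℂ) ‖b‖ := by
    rw [mem_closedBall_zero_iff, norm_smul, norm_inv]
    exact mul_le_of_le_one_left (norm_nonneg _) (inv_le_one_of_one_le₀ hc)
  calc ‖c‖ ^ n * ‖a ⟨0, hn⟩‖ ^ n * ‖g (c⁻¹ • b)‖
      ≤ ‖c‖ ^ n * ‖a ⟨0, hn⟩‖ ^ n * M := by gcongr; exact hM _ hball
    _ = ‖a ⟨0, hn⟩‖ ^ n * M * ‖c‖ ^ n := by ring

/-- **Proposition 2.1 (analytic content).** Let `n ≥ 1` and let `f, g : ℂⁿ → ℂ` be entire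
holomorphic functions with `f(a) = a₀ⁿ g(ιₙ(a))` whenever `a₀ ≠ 0`. Then `f` and `g` are
polynomial functions of total degree at most `n`. -/
theorem stmt19 (n : ℕ) (hn : 1 ≤ n) (f g : (Fin n → ℂ) → ℂ)
    (hf : ∀ x, AnalyticAt ℂ f x) (hg : ∀ x, AnalyticAt ℂ g x)
    (hrel : ∀ a : Fin n → ℂ, a ⟨0, hn⟩ ≠ 0 →
      f a = (a ⟨0, hn⟩) ^ n *
        g (fun i => iota (fun j => if h : j < n then a ⟨j, h⟩ else 0) (i : ℕ))) :
    ∃ P Q : MvPolynomial (Fin n) ℂ, P.totalDegree ≤ n ∧ Q.totalDegree ≤ n ∧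
      (∀ a, f a = MvPolynomial.eval a P) ∧ (∀ a, g a = MvPolynomial.eval a Q) := by
  have hfc : Continuous f := continuous_iff_continuousAt.mpr fun x => (hf x).continuousAt
  have hgc : Continuous g := continuous_iff_continuousAt.mpr fun x => (hg x).continuousAt
  obtain ⟨P, hPdeg, hP⟩ := exists_mvPolynomial_of_iota_rel n hn f g hf hgc hrel
  obtain ⟨Q, hQdeg, hQ⟩ := exists_mvPolynomial_of_iota_rel n hn g f hg hfc (by
    intro b hb
    set b' : ℕ → ℂ := fun j => if h : j < n then b ⟨j, h⟩ else 0
    have hb'0 : b' 0 = b ⟨0, hn⟩ := dif_pos hn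
    have ha0 : iota b' 0 = (b ⟨0, hn⟩)⁻¹ := by rw [iota, hb'0, one_div]
    have hι : (fun i : Fin n => iota (fun j => if h : j < n then
        (fun i : Fin n => iota b' (i : ℕ)) ⟨j, h⟩ else 0) (i : ℕ)) = b := by
      funext i
      rw [iota_iota n b' _ (hb'0 ▸ hb) hn (fun k hk => dif_pos hk) i i.isLt]
      exact dif_pos i.isLt
    rw [hrel (fun i : Fin n => iota b' (i : ℕ)) (by simpa [ha0] using hb), hι]
    simp only [ha0]
    rw [← mul_assoc, ← mul_pow, mul_inv_cancel₀ hb, one_pow, one_mul])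
  exact ⟨P, Q, hPdeg, hQdeg, hP, hQ⟩
end
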